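/- Let n = 3 and suppose f is a transcendental entire function of finite order on ℂ solving the differential-difference equation f(z)^n + w·f(z)^{n-1}·f'(z) + q(z)e^{Q(z)}·f(z+c) = p₁e^{α₁z} + p₂e^{α₂z}, and suppose λ(f) < ρ(f). Then ρ(f) = deg Q = 1. -/

import Mathlib

open MeasureTheory Filter Metric

noncomputable section

/-- The positive part `log⁺` of the logarithm. -/
def logPlus (x : ℝ) : ℝ := max (Real.log x) 0

/-- The Nevanlinna proximity function `m(r,f)`.  For an entire function `f` (which has no
poles) this coincides with the Nevanlinna characteristic `T(r,f)`. -/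
def nevCharEntire (f : ℂ → ℂ) (r : ℝ) : ℝ :=
  (2 * Real.pi)⁻¹ * ∫ θ in (0:ℝ)..(2 * Real.pi), logPlus ‖f (r * Complex.exp (θ * Complex.I))‖

/-- The order of growth `ρ(f) = limsup_{r→∞} log⁺ T(r,f) / log r` of an entire function,
as an extended real number. -/
def growthOrderEntire (f : ℂ → ℂ) : EReal :=
  Filter.limsup (fun r : ℝ => ((logPlus (nevCharEntire f r) / Real.log r : ℝ) : EReal))
    Filter.atTop

/-- An entire function is transcendental if it is not a polynomial. -/
def TranscendentalEntire (f : ℂ → ℂ) : Prop := ¬ ∃ p : Polynomial ℂ, ∀ z, f z = p.eval z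

/-- The multiplicity of `z` as a zero of an entire function `f`: the smallest `k` such that
the `k`-th derivative of `f` does not vanish at `z` (`0` if `f z ≠ 0`). -/
def zeroMult (f : ℂ → ℂ) (z : ℂ) : ℕ := sInf {k : ℕ | iteratedDeriv k f z ≠ 0}

/-- The unintegrated counting function `n(r, 1/f)`: the number of zeros of `f`, counted with
multiplicity, in the closed disc `|z| ≤ r`. -/
def zeroCount (f : ℂ → ℂ) (r : ℝ) : ℕ := ∑ᶠ z ∈ Metric.closedBall (0:ℂ) r, zeroMult f z

/-- The exponent of convergence of the zeros of `f`:
`λ(f) = limsup_{r→∞} log⁺ n(r,1/f) / log r`, as an extended real number. -/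
def zeroExponent (f : ℂ → ℂ) : EReal :=
  Filter.limsup (fun r : ℝ => ((logPlus (zeroCount f r) / Real.log r : ℝ) : EReal))
    Filter.atTop

/-- `HasExpGrowth σ F` says that `F` is entire and satisfies a pointwise bound
`‖F z‖ ≤ exp (C (1 + ‖z‖) ^ σ)`. -/
def HasExpGrowth (σ : ℝ) (F : ℂ → ℂ) : Prop :=
  Differentiable ℂ F ∧ ∃ C : ℝ, 0 ≤ C ∧ ∀ z, ‖F z‖ ≤ Real.exp (C * (1 + ‖z‖) ^ σ)

namespace HasExpGrowth

variable {σ τ : ℝ} {F G : ℂ → ℂ}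

lemma mono (hF : HasExpGrowth σ F) (h : σ ≤ τ) : HasExpGrowth τ F := by
  obtain ⟨hd, C, hC, hb⟩ := hF
  refine ⟨hd, C, hC, fun z ↦ (hb z).trans ?_⟩
  gcongr
  linarith [norm_nonneg z]

lemma mul (hF : HasExpGrowth σ F) (hG : HasExpGrowth σ G) :
    HasExpGrowth σ (fun z ↦ F z * G z) := by
  obtain ⟨hd, C, hC, hb⟩ := hF
  obtain ⟨hd', C', hC', hb'⟩ := hG
  refine ⟨hd.mul hd', C + C', by positivity, fun z ↦ ?_⟩
  rw [norm_mul, add_mul, Real.exp_add]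
  gcongr
  exacts [hb z, hb' z]

lemma one_le_base (hσ : 0 ≤ σ) (z : ℂ) : 1 ≤ (1 + ‖z‖) ^ σ :=
  Real.one_le_rpow (by linarith [norm_nonneg z]) hσ

lemma const (hσ : 0 ≤ σ) (a : ℂ) : HasExpGrowth σ (fun _ ↦ a) := by
  refine ⟨differentiable_const _, ‖a‖, norm_nonneg _, fun z ↦ ?_⟩
  have := one_le_base hσ z
  calc ‖a‖ ≤ ‖a‖ * (1 + ‖z‖) ^ σ := le_mul_of_one_le_right (norm_nonneg _) this
    _ ≤ _ := by linarith [Real.add_one_le_exp (‖a‖ * (1 + ‖z‖) ^ σ)]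

lemma add (hσ : 0 ≤ σ) (hF : HasExpGrowth σ F) (hG : HasExpGrowth σ G) :
    HasExpGrowth σ (fun z ↦ F z + G z) := by
  obtain ⟨hd, C, hC, hb⟩ := hF
  obtain ⟨hd', C', hC', hb'⟩ := hG
  refine ⟨hd.add hd', 1 + (C + C'), by positivity, fun z ↦ ?_⟩
  have h1 := one_le_base hσ z
  set x := (1 + ‖z‖) ^ σ
  have h2 : Real.exp (C * x) ≤ Real.exp ((C + C') * x) := by gcongr; linarith
  have h3 : Real.exp (C' * x) ≤ Real.exp ((C + C') * x) := by gcongr; linarith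
  have h4 : 2 ≤ Real.exp x := by linarith [Real.add_one_le_exp x]
  rw [add_mul, one_mul, Real.exp_add]
  calc ‖F z + G z‖ ≤ ‖F z‖ + ‖G z‖ := norm_add_le _ _
    _ ≤ 2 * Real.exp ((C + C') * x) := by linarith [hb z, hb' z]
    _ ≤ _ := by gcongr

lemma const_mul (hσ : 0 ≤ σ) (a : ℂ) (hF : HasExpGrowth σ F) :
    HasExpGrowth σ (fun z ↦ a * F z) :=
  (const hσ a).mul hF

lemma sub (hσ : 0 ≤ σ) (hF : HasExpGrowth σ F) (hG : HasExpGrowth σ G) :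
    HasExpGrowth σ (fun z ↦ F z - G z) := by
  simpa [sub_eq_add_neg] using hF.add hσ (hG.const_mul hσ (-1))

lemma pow (hσ : 0 ≤ σ) (hF : HasExpGrowth σ F) (n : ℕ) :
    HasExpGrowth σ (fun z ↦ F z ^ n) := by
  induction n with
  | zero => simpa using const hσ 1
  | succ n ih => simpa [pow_succ] using ih.mul hF

lemma comp_add_const (hσ : 0 ≤ σ) (hF : HasExpGrowth σ F) (c : ℂ) :
    HasExpGrowth σ (fun z ↦ F (z + c)) := by
  obtain ⟨hd, C, hC, hb⟩ := hF
  refine ⟨hd.comp (differentiable_id.add_const c), C * (1 + ‖c‖) ^ σ, by positivity, fun z ↦ ?_⟩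
  refine (hb _).trans ?_
  rw [mul_assoc, ← Real.mul_rpow (by positivity) (by positivity)]
  gcongr
  nlinarith [norm_add_le z c, norm_nonneg z, norm_nonneg c]

lemma deriv (hσ : 0 ≤ σ) (hF : HasExpGrowth σ F) : HasExpGrowth σ (deriv F) := by
  obtain ⟨hd, C, hC, hb⟩ := hF
  have hd' : Differentiable ℂ (_root_.deriv F) := hd.deriv
  refine ⟨hd', C * 2 ^ σ, by positivity, fun z ↦ ?_⟩
  rw [← div_one (Real.exp _)]
  refine Complex.norm_deriv_le_of_forall_mem_sphere_norm_le one_pos hd.diffContOnCl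
    fun w hw ↦ (hb w).trans ?_
  rw [mul_assoc, ← Real.mul_rpow (by positivity) (by positivity)]
  gcongr
  have h1 : ‖w - z‖ = 1 := by simpa [dist_eq_norm] using hw
  have h2 : ‖w‖ ≤ ‖w - z‖ + ‖z‖ := by simpa using norm_add_le (w - z) z
  linarith [norm_nonneg z]

lemma polynomial_norm_le (P : Polynomial ℂ) {n : ℕ} (hn : P.natDegree ≤ n) :
    ∃ C : ℝ, 0 ≤ C ∧ ∀ z, ‖P.eval z‖ ≤ C * (1 + ‖z‖) ^ n := by
  refine ⟨∑ i ∈ Finset.range (P.natDegree + 1), ‖P.coeff i‖, by positivity, fun z ↦ ?_⟩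
  rw [Polynomial.eval_eq_sum_range, Finset.sum_mul]
  refine (norm_sum_le _ _).trans (Finset.sum_le_sum fun i hi ↦ ?_)
  rw [norm_mul, norm_pow]
  have hi' : i ≤ n := (Nat.lt_succ_iff.1 (Finset.mem_range.1 hi)).trans hn
  have h0 := norm_nonneg z
  gcongr
  calc ‖z‖ ^ i ≤ (1 + ‖z‖) ^ i := by gcongr; linarith
    _ ≤ _ := pow_le_pow_right₀ (by linarith) hi'

lemma exp_polynomial (P : Polynomial ℂ) (h : (P.natDegree : ℝ) ≤ σ) :
    HasExpGrowth σ (fun z ↦ Complex.exp (P.eval z)) := by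
  obtain ⟨C, hC, hb⟩ := polynomial_norm_le P le_rfl
  refine mono ⟨by fun_prop, C, hC, fun z ↦ ?_⟩ h
  rw [Complex.norm_exp, Real.rpow_natCast]
  gcongr
  exact (Complex.re_le_norm _).trans (hb z)

lemma id (hσ : 0 < σ) : HasExpGrowth σ (fun z ↦ z) := by
  refine ⟨differentiable_id, σ⁻¹, by positivity, fun z ↦ ?_⟩
  have h0 := norm_nonneg z
  have h1 := Real.log_le_rpow_div (x := 1 + ‖z‖) (by positivity) hσ
  rw [div_eq_inv_mul] at h1
  calc ‖z‖ ≤ Real.exp (Real.log (1 + ‖z‖)) := by rw [Real.exp_log (by positivity)]; linarith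
    _ ≤ _ := by gcongr

lemma polynomial (hσ : 0 < σ) (P : Polynomial ℂ) : HasExpGrowth σ (fun z ↦ P.eval z) := by
  induction P using Polynomial.induction_on' with
  | add p q hp hq => simpa using hp.add hσ.le hq
  | monomial n a => simpa using ((id hσ).pow hσ.le n).const_mul hσ.le a

lemma nevCharEntire_le (hF : HasExpGrowth σ F) :
    ∃ C : ℝ, 0 ≤ C ∧ ∀ r : ℝ, 0 ≤ r → nevCharEntire F r ≤ C * (1 + r) ^ σ := by
  obtain ⟨hd, C, hC, hb⟩ := hF
  refine ⟨C, hC, fun r hr ↦ ?_⟩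
  have hpi := Real.pi_pos
  rw [nevCharEntire, inv_mul_le_iff₀ (by positivity)]
  have hcont : Continuous fun θ : ℝ ↦ logPlus ‖F (r * Complex.exp (θ * Complex.I))‖ := by
    have h1 : Continuous fun θ : ℝ ↦ F (r * Complex.exp (θ * Complex.I)) :=
      hd.continuous.comp (by fun_prop)
    have h2 : logPlus = Real.posLog := by ext x; simp [logPlus, Real.posLog, max_comm]
    rw [h2]
    exact Real.continuous_posLog.comp h1.norm
  have := intervalIntegral.integral_mono_on (a := 0) (b := 2 * Real.pi) (by positivity)
    (hcont.intervalIntegrable _ _) (intervalIntegrable_const (c := C * (1 + r) ^ σ)) (μ := volume)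
    (fun θ _ ↦ ?_)
  · exact this.trans_eq (by rw [intervalIntegral.integral_const, smul_eq_mul, sub_zero])
  · refine max_le ?_ (by positivity)
    have h := hb (r * Complex.exp (θ * Complex.I))
    rw [norm_mul (r : ℂ), Complex.norm_exp_ofReal_mul_I, Complex.norm_real, Real.norm_of_nonneg hr,
      mul_one] at h
    rcases eq_or_lt_of_le (norm_nonneg (F (r * Complex.exp (θ * Complex.I)))) with h0 | h0
    · rw [← h0, Real.log_zero]; positivity
    · exact (Real.log_le_iff_le_exp h0).2 h

end HasExpGrowth

lemma nevCharEntire_eq_circleAverage (f : ℂ → ℂ) (r : ℝ) :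
    nevCharEntire f r = Real.circleAverage (fun z ↦ Real.posLog ‖f z‖) 0 r := by
  simp [nevCharEntire, Real.circleAverage_def, circleMap, logPlus, Real.posLog, max_comm]

lemma Differentiable.meromorphicOn {f : ℂ → ℂ} (hf : Differentiable ℂ f) (s : Set ℂ) :
    MeromorphicOn f s :=
  fun z _ ↦ (hf.analyticAt z).meromorphicAt

lemma Differentiable.analyticOrderAt_ne_top {f : ℂ → ℂ} (hf : Differentiable ℂ f)
    (h0 : ∃ z, f z ≠ 0) (z : ℂ) : analyticOrderAt f z ≠ ⊤ := by
  intro h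
  obtain ⟨w, hw⟩ := h0
  refine hw ?_
  have := AnalyticOnNhd.eqOn_zero_of_preconnected_of_eventuallyEq_zero
    (fun z _ ↦ hf.analyticAt z) isPreconnected_univ (Set.mem_univ z) (analyticOrderAt_eq_top.1 h)
  exact this (Set.mem_univ w)

lemma Differentiable.eventually_codiscrete_ne_zero {f : ℂ → ℂ} (hf : Differentiable ℂ f)
    (h0 : ∃ z, f z ≠ 0) : ∀ᶠ z in codiscrete ℂ, f z ≠ 0 := by
  obtain ⟨w, hw⟩ := h0
  have := AnalyticOnNhd.preimage_zero_mem_codiscrete (f := f) (x := w)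
    (fun z _ ↦ hf.analyticAt z) hw
  filter_upwards [this] with z hz
  simpa using hz

lemma exists_circleAverage_abs_log_norm_le {f : ℂ → ℂ} (hf : Differentiable ℂ f) :
    ∃ C : ℝ, ∀ r : ℝ, 1 ≤ r →
      Real.circleAverage (fun z ↦ |Real.log ‖f z‖|) 0 r ≤ 2 * nevCharEntire f r + C := by
  refine ⟨-Real.log ‖meromorphicTrailingCoeffAt f 0‖, fun r hr ↦ ?_⟩
  have hr0 : r ≠ 0 := by positivity
  have hm : MeromorphicOn f (closedBall 0 |r|) := hf.meromorphicOn _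
  have hint1 : CircleIntegrable (fun z ↦ Real.log ‖f z‖) 0 r :=
    MeromorphicOn.circleIntegrable_log_norm (hf.meromorphicOn _)
  have hint2 : CircleIntegrable (fun z ↦ Real.posLog ‖f z‖) 0 r :=
    MeromorphicOn.circleIntegrable_posLog_norm (hf.meromorphicOn _)
  have hdiv := MeromorphicOn.AnalyticOnNhd.divisor_nonneg (f := f) (U := closedBall 0 |r|)
    (fun z _ ↦ hf.analyticAt z)
  have hlog : Real.log ‖meromorphicTrailingCoeffAt f 0‖
      ≤ Real.circleAverage (fun z ↦ Real.log ‖f z‖) 0 r := by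
    rw [MeromorphicOn.circleAverage_log_norm hr0 hm]
    have h1 : 0 ≤ ∑ᶠ u, (MeromorphicOn.divisor f (closedBall 0 |r|) u : ℝ)
        * Real.log (r * ‖0 - u‖⁻¹) := by
      refine finsum_nonneg fun u ↦ ?_
      by_cases hu : u ∈ closedBall 0 |r|
      · refine mul_nonneg (by exact_mod_cast hdiv u) ?_
        rw [zero_sub, norm_neg]
        rcases eq_or_ne u 0 with rfl | hu0
        · simp
        refine Real.log_nonneg ?_
        rw [← div_eq_mul_inv, one_le_div (norm_pos_iff.2 hu0)]
        simpa [abs_of_nonneg (zero_le_one.trans hr)] using hu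
      · simp [hu]
    have h2 : 0 ≤ (MeromorphicOn.divisor f (closedBall 0 |r|) 0 : ℝ) * Real.log r :=
      mul_nonneg (by exact_mod_cast hdiv 0) (Real.log_nonneg hr)
    linarith
  have habs : (fun z ↦ |Real.log ‖f z‖|)
      = fun z ↦ (2 : ℝ) • Real.posLog ‖f z‖ - Real.log ‖f z‖ := by
    ext z
    rw [← Real.half_mul_log_add_log_abs, smul_eq_mul]
    ring
  rw [habs, Real.circleAverage_fun_sub (hint2.const_fun_smul) hint1,
    Real.circleAverage_fun_smul, nevCharEntire_eq_circleAverage, smul_eq_mul]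
  linarith

lemma exists_circleAverage_abs_re_le {U V g : ℂ → ℂ} (hU : Differentiable ℂ U)
    (hV : Differentiable ℂ V) (h0 : ∃ z, U z ≠ 0)
    (h : ∀ z, U z * Complex.exp (g z) = V z) :
    ∃ C : ℝ, ∀ r : ℝ, 1 ≤ r → Real.circleAverage (fun z ↦ |(g z).re|) 0 r
      ≤ 2 * nevCharEntire U r + 2 * nevCharEntire V r + C := by
  obtain ⟨C₁, h₁⟩ := exists_circleAverage_abs_log_norm_le hU
  obtain ⟨C₂, h₂⟩ := exists_circleAverage_abs_log_norm_le hV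
  refine ⟨C₁ + C₂, fun r hr ↦ ?_⟩
  have hr0 : r ≠ 0 := by positivity
  have hint1 : CircleIntegrable (fun z ↦ Real.log ‖U z‖) 0 r :=
    MeromorphicOn.circleIntegrable_log_norm (hU.meromorphicOn _)
  have hint2 : CircleIntegrable (fun z ↦ Real.log ‖V z‖) 0 r :=
    MeromorphicOn.circleIntegrable_log_norm (hV.meromorphicOn _)
  have hcongr : (fun z ↦ |(g z).re|) =ᶠ[codiscreteWithin (sphere 0 |r|)]
      fun z ↦ |Real.log ‖V z‖ - Real.log ‖U z‖| := by
    have := hU.eventually_codiscrete_ne_zero h0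
    filter_upwards [this.filter_mono (codiscreteWithin_mono (Set.subset_univ _))] with z hz
    rw [← h z, norm_mul, Real.log_mul (norm_ne_zero_iff.2 hz)
      (norm_ne_zero_iff.2 (Complex.exp_ne_zero _)), Complex.norm_exp, Real.log_exp]
    ring_nf
  rw [Real.circleAverage_congr_codiscreteWithin hcongr hr0]
  have hmono : Real.circleAverage (fun z ↦ |Real.log ‖V z‖ - Real.log ‖U z‖|) 0 r
      ≤ Real.circleAverage (fun z ↦ |Real.log ‖V z‖| + |Real.log ‖U z‖|) 0 r := by
    refine Real.circleAverage_mono (hint2.sub hint1).abs (hint2.abs.add hint1.abs) fun z _ ↦ ?_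
    exact abs_sub _ _
  have habs1 : CircleIntegrable (fun z ↦ |Real.log ‖U z‖|) 0 r := hint1.abs
  have habs2 : CircleIntegrable (fun z ↦ |Real.log ‖V z‖|) 0 r := hint2.abs
  have hadd := Real.circleAverage_fun_add habs2 habs1
  linarith [h₁ r hr, h₂ r hr]

lemma abs_re_le_circleAverage {g : ℂ → ℂ} (hg : Differentiable ℂ g) {r : ℝ} (hr : 0 < r)
    {w : ℂ} (hw : ‖w‖ ≤ r / 2) :
    |(g w).re| ≤ 3 * Real.circleAverage (fun z ↦ |(g z).re|) 0 r := by
  have hwb : w ∈ ball (0 : ℂ) r := by simp; linarith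
  have hint : CircleIntegrable (fun z ↦ |(g z).re|) 0 r :=
    (Continuous.continuousOn (by have := hg.continuous; fun_prop)).circleIntegrable'
  have hker : ∀ z ∈ sphere (0 : ℂ) r, |poissonKernel 0 w z| ≤ 3 := by
    intro z hz
    have h1 := le_re_herglotzRieszKernel hz hwb
    have h2 := re_herglotzRieszKernel_le hz hwb
    have h3 : poissonKernel 0 w z = ((z - 0 + (w - 0)) / ((z - 0) - (w - 0))).re := by
      rw [poissonKernel_eq_re_herglotzRieszKernel]; rfl
    rw [h3, abs_le]
    rw [sub_zero w] at h1 h2 ⊢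
    have h4 : 0 < r - ‖w‖ := by linarith [norm_nonneg w]
    constructor
    · have : 0 ≤ (r - ‖w‖) / (r + ‖w‖) := by positivity
      linarith
    · refine h2.trans ?_
      rw [div_le_iff₀ h4]
      linarith
  have hkc : ContinuousOn (poissonKernel 0 w) (sphere 0 |r|) := by
    unfold poissonKernel
    refine ContinuousOn.div (by fun_prop) (by fun_prop) fun z hz ↦ ?_
    have hz' : ‖z‖ = r := by simpa [abs_of_pos hr] using hz
    have : z ≠ w := by rintro rfl; linarith
    simpa [sub_eq_zero] using this
  have hP := DiffContOnCl.circleAverage_poissonKernel_smul (hg.diffContOnCl (s := ball 0 r)) hwb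
  have hgc := hg.continuous
  have hci : CircleIntegrable (poissonKernel 0 w • g) 0 r :=
    (ContinuousOn.smul hkc hgc.continuousOn).circleIntegrable'
  have hre : Real.circleAverage (fun z ↦ poissonKernel 0 w z * (g z).re) 0 r = (g w).re := by
    rw [← hP]
    have := Complex.reCLM.circleAverage_comp_comm hci
    rw [← Complex.reCLM_apply, ← this]
    congr 1
    ext z
    simp
  rw [← hre]
  refine Real.abs_circleAverage_le_circleAverage_abs.trans ?_
  rw [← smul_eq_mul, ← Real.circleAverage_fun_smul]
  refine Real.circleAverage_mono ?_ hint.const_fun_smul fun z hz ↦ ?_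
  · exact (ContinuousOn.abs (hkc.mul (by fun_prop))).circleIntegrable'
  · rw [abs_of_pos hr] at hz
    simp only [Pi.abs_apply, abs_mul, smul_eq_mul]
    gcongr
    exact hker z hz

lemma exists_polynomial_of_circleAverage_le {g : ℂ → ℂ} (hg : Differentiable ℂ g) {σ C : ℝ}
    (hσ : 0 ≤ σ)
    (h : ∀ᶠ r : ℝ in atTop, Real.circleAverage (fun z ↦ |(g z).re|) 0 r ≤ C * r ^ σ) :
    ∃ P : Polynomial ℂ, (P.natDegree : ℝ) ≤ σ ∧ ∀ z, g z = P.eval z := by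
  have hzero : ∀ k : ℕ, σ < k → iteratedDeriv k g 0 = 0 := by
    intro k hk
    set M : ℝ := 6 * (|C| + 1) + 3 * ‖g 0‖ with hM
    have hMpos : 0 ≤ M := by positivity
    have hbd : ∀ᶠ r : ℝ in atTop,
        ‖iteratedDeriv k g 0‖ ≤ (k.factorial * M * 4 ^ k) * r ^ (-(k - σ)) := by
      filter_upwards [h, eventually_ge_atTop 1] with r hr hr1
      have hr0 : 0 < r := by linarith
      have hrσ : 1 ≤ r ^ σ := Real.one_le_rpow hr1 hσ
      have hsph : ∀ z ∈ sphere (0 : ℂ) (r / 4), ‖g z‖ ≤ M * r ^ σ := by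
        intro z hz
        have hz' : ‖z‖ = r / 4 := by simpa using hz
        have hA : 0 < 3 * ((|C| + 1) * r ^ σ) := by positivity
        have := Complex.borelCaratheodory hA (R := r / 2) (z := z) hg.differentiableOn
          (fun w hw ↦ ?_) (by positivity) (by simp [hz']; linarith)
        · rw [hz'] at this
          refine this.trans ?_
          have e1 : 2 * (3 * ((|C| + 1) * r ^ σ)) * (r / 4) / (r / 2 - r / 4)
              = 6 * (|C| + 1) * r ^ σ := by field_simp; ring
          have e2 : ‖g 0‖ * (r / 2 + r / 4) / (r / 2 - r / 4) = 3 * ‖g 0‖ := by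
            field_simp; ring
          rw [e1, e2, hM, add_mul]
          exact add_le_add le_rfl (le_mul_of_one_le_right (by positivity) hrσ)
        · have hw' : ‖w‖ < r / 2 := by simpa using hw
          refine (le_abs_self _).trans ((abs_re_le_circleAverage hg hr0 hw'.le).trans ?_)
          gcongr
          refine hr.trans ?_
          gcongr
          linarith [le_abs_self C]
      refine (Complex.norm_iteratedDeriv_le_of_forall_mem_sphere_norm_le k (by positivity)
        hg.diffContOnCl hsph).trans (le_of_eq ?_)
      rw [neg_sub, Real.rpow_sub hr0, Real.rpow_natCast, div_pow]
      field_simp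
    have hlim : Tendsto (fun r : ℝ ↦ (k.factorial * M * 4 ^ k) * r ^ (-(k - σ))) atTop
        (nhds 0) := by
      simpa using (tendsto_rpow_neg_atTop (sub_pos.2 hk)).const_mul (k.factorial * M * 4 ^ k)
    have := ge_of_tendsto hlim hbd
    exact norm_eq_zero.1 (le_antisymm this (norm_nonneg _))
  have hfl : ∀ k : ℕ, k ∉ Finset.range (⌊σ⌋₊ + 1) → σ < k := by
    intro k hk
    exact (Nat.floor_lt hσ).1 (by rw [Finset.mem_range] at hk; omega)
  refine ⟨∑ k ∈ Finset.range (⌊σ⌋₊ + 1),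
    Polynomial.monomial k ((k.factorial : ℂ)⁻¹ * iteratedDeriv k g 0), ?_, fun z ↦ ?_⟩
  · refine le_trans ?_ (Nat.floor_le hσ)
    norm_cast
    refine Polynomial.natDegree_sum_le_of_forall_le _ _ fun k hk ↦ ?_
    exact (Polynomial.natDegree_monomial_le _).trans (by simpa [Nat.lt_succ_iff] using hk)
  · rw [← Complex.taylorSeries_eq_of_entire hg 0 z, tsum_eq_sum (s := Finset.range (⌊σ⌋₊ + 1)),
      Polynomial.eval_finsetSum]
    · refine Finset.sum_congr rfl fun k _ ↦ ?_
      simp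
      ring
    · intro k hk
      simp [hzero k (hfl k hk)]

/-- If `U e ^ g = V` where `U` and `V` have Nevanlinna characteristic `O(r ^ σ)`, then `g` is a
polynomial of degree at most `σ`. -/
lemma exists_polynomial_of_mul_exp_eq {U V g : ℂ → ℂ} (hU : Differentiable ℂ U)
    (hV : Differentiable ℂ V) (hg : Differentiable ℂ g) (h0 : ∃ z, U z ≠ 0)
    (h : ∀ z, U z * Complex.exp (g z) = V z) {σ C : ℝ} (hσ : 0 ≤ σ)
    (hTU : ∀ᶠ r : ℝ in atTop, nevCharEntire U r ≤ C * r ^ σ)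
    (hTV : ∀ᶠ r : ℝ in atTop, nevCharEntire V r ≤ C * r ^ σ) :
    ∃ P : Polynomial ℂ, (P.natDegree : ℝ) ≤ σ ∧ ∀ z, g z = P.eval z := by
  obtain ⟨D, hD⟩ := exists_circleAverage_abs_re_le hU hV h0 h
  refine exists_polynomial_of_circleAverage_le hg (C := 4 * C + |D|) hσ ?_
  filter_upwards [hTU, hTV, eventually_ge_atTop 1] with r h1 h2 hr
  have hrσ : 1 ≤ r ^ σ := Real.one_le_rpow hr hσ
  have h3 := hD r hr
  have h4 : D ≤ |D| * r ^ σ :=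
    (le_abs_self D).trans (le_mul_of_one_le_right (abs_nonneg _) hrσ)
  rw [add_mul]
  linarith

lemma HasExpGrowth.eventually_nevCharEntire_le {σ : ℝ} {F : ℂ → ℂ} (hσ : 0 ≤ σ)
    (hF : HasExpGrowth σ F) :
    ∃ C : ℝ, 0 ≤ C ∧ ∀ᶠ r : ℝ in atTop, nevCharEntire F r ≤ C * r ^ σ := by
  obtain ⟨C, hC, h⟩ := hF.nevCharEntire_le
  refine ⟨C * 2 ^ σ, by positivity, ?_⟩
  filter_upwards [eventually_ge_atTop 1] with r hr
  refine (h r (by linarith)).trans ?_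
  rw [mul_assoc, ← Real.mul_rpow (by positivity) (by positivity)]
  gcongr
  linarith

lemma HasExpGrowth.natDegree_le {σ : ℝ} (hσ : 0 ≤ σ) {U V : ℂ → ℂ} (hU : HasExpGrowth σ U)
    (hV : HasExpGrowth σ V) (h0 : ∃ z, U z ≠ 0) {P : Polynomial ℂ}
    (h : ∀ z, U z * Complex.exp (P.eval z) = V z) : (P.natDegree : ℝ) ≤ σ := by
  obtain ⟨C, hC, h1⟩ := hU.eventually_nevCharEntire_le hσ
  obtain ⟨D, hD, h2⟩ := hV.eventually_nevCharEntire_le hσ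
  obtain ⟨P', hP', hPP'⟩ := exists_polynomial_of_mul_exp_eq hU.1 hV.1 P.differentiable h0 h
    (C := max C D) hσ
    (by
      filter_upwards [h1, eventually_ge_atTop 0] with r hr hr0
      exact hr.trans (by gcongr; exact le_max_left _ _))
    (by
      filter_upwards [h2, eventually_ge_atTop 0] with r hr hr0
      exact hr.trans (by gcongr; exact le_max_right _ _))
  rwa [Polynomial.funext hPP']

/-- The Weierstrass elementary factor `E_p`, evaluated at `-u`. -/
def elementaryFactor (p : ℕ) (u : ℂ) : ℂ := (1 + u) * Complex.exp (-Complex.logTaylor (p + 1) u)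

lemma elementaryFactor_zero (p : ℕ) : elementaryFactor p 0 = 1 := by
  simp [elementaryFactor, Complex.logTaylor_at_zero]

lemma differentiable_logTaylor (n : ℕ) : Differentiable ℂ (Complex.logTaylor n) := by
  unfold Complex.logTaylor
  fun_prop

lemma differentiable_elementaryFactor (p : ℕ) : Differentiable ℂ (elementaryFactor p) := by
  have := differentiable_logTaylor (p + 1)
  unfold elementaryFactor
  fun_prop

lemma elementaryFactor_ne_zero (p : ℕ) {u : ℂ} (hu : 1 + u ≠ 0) : elementaryFactor p u ≠ 0 :=
  mul_ne_zero hu (Complex.exp_ne_zero _)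

lemma exists_elementaryFactor_eq_exp {σ : ℝ} {u : ℂ} (hu : ‖u‖ ≤ 1 / 2) :
    ∃ l, elementaryFactor ⌊σ⌋₊ u = Complex.exp l ∧ ‖l‖ ≤ 2 * ‖u‖ ^ σ := by
  have hu1 : ‖u‖ < 1 := by linarith
  have hne : 1 + u ≠ 0 := by
    intro h
    have : u = -1 := by linear_combination h
    rw [this] at hu1
    simp at hu1
  refine ⟨Complex.log (1 + u) - Complex.logTaylor (⌊σ⌋₊ + 1) u, ?_, ?_⟩
  · rw [sub_eq_add_neg, Complex.exp_add, Complex.exp_log hne, elementaryFactor]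
  · refine (Complex.norm_log_sub_logTaylor_le _ hu1).trans ?_
    have h1 : ‖u‖ ^ (⌊σ⌋₊ + 1) ≤ ‖u‖ ^ σ := by
      rw [← Real.rpow_natCast]
      refine Real.rpow_le_rpow_of_exponent_ge_of_imp (norm_nonneg _) hu1.le ?_ ?_
      · push_cast
        exact (Nat.lt_floor_add_one σ).le
      · intro _ h
        exact absurd h (by positivity)
    have h2 : (1 - ‖u‖)⁻¹ ≤ 2 := by
      rw [inv_le_comm₀ (by linarith) (by norm_num)]
      linarith
    have h3 : (0 : ℝ) ≤ (1 - ‖u‖)⁻¹ := inv_nonneg.2 (by linarith)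
    calc ‖u‖ ^ (⌊σ⌋₊ + 1) * (1 - ‖u‖)⁻¹ / (⌊σ⌋₊ + 1)
        ≤ ‖u‖ ^ (⌊σ⌋₊ + 1) * (1 - ‖u‖)⁻¹ :=
          div_le_self (by positivity) (by linarith [Nat.cast_nonneg (α := ℝ) ⌊σ⌋₊])
      _ ≤ ‖u‖ ^ σ * 2 := by gcongr
      _ = 2 * ‖u‖ ^ σ := mul_comm _ _

lemma norm_logTaylor_le {n : ℕ} {u : ℂ} {b : ℝ} (h : ∀ j < n, ‖u‖ ^ j ≤ b) (hb : 0 ≤ b) :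
    ‖Complex.logTaylor n u‖ ≤ n * b := by
  rw [Complex.logTaylor]
  refine (norm_sum_le _ _).trans ((Finset.sum_le_card_nsmul _ _ b fun j hj ↦ ?_).trans ?_)
  · rcases Nat.eq_zero_or_pos j with rfl | hj0
    · simpa using hb
    · rw [norm_div, norm_mul, norm_pow, norm_pow, norm_neg, norm_one, one_pow, one_mul,
        Complex.norm_natCast]
      refine (div_le_self (by positivity) (by exact_mod_cast hj0)).trans (h j ?_)
      simpa using hj
  · simp

lemma exists_norm_elementaryFactor_le {σ : ℝ} (hσ : 0 < σ) :
    ∃ C : ℝ, 0 ≤ C ∧ ∀ u, ‖elementaryFactor ⌊σ⌋₊ u‖ ≤ Real.exp (C * ‖u‖ ^ σ) := by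
  refine ⟨2 + 3 ^ σ / σ + (⌊σ⌋₊ + 1) * 2 ^ σ, by positivity, fun u ↦ ?_⟩
  rcases le_or_gt ‖u‖ (1 / 2) with hu | hu
  · obtain ⟨l, hl, hl'⟩ := exists_elementaryFactor_eq_exp (σ := σ) hu
    rw [hl, Complex.norm_exp]
    refine Real.exp_le_exp.2 (((Complex.re_le_norm l).trans hl').trans ?_)
    gcongr
    rw [add_assoc]
    exact le_add_of_nonneg_right (by positivity)
  · have h1 : ‖1 + u‖ ≤ Real.exp (3 ^ σ / σ * ‖u‖ ^ σ) := by
      have h2 : ‖1 + u‖ ≤ 1 + ‖u‖ := (norm_add_le _ _).trans (by simp)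
      refine h2.trans ((Real.le_exp_log _).trans (Real.exp_le_exp.2 ?_))
      refine (Real.log_le_rpow_div (by positivity) hσ).trans ?_
      rw [div_mul_eq_mul_div, ← Real.mul_rpow (by norm_num) (norm_nonneg _)]
      gcongr
      linarith
    have h3 : ‖Complex.logTaylor (⌊σ⌋₊ + 1) u‖ ≤ (⌊σ⌋₊ + 1) * (2 * ‖u‖) ^ σ := by
      have := norm_logTaylor_le (n := ⌊σ⌋₊ + 1) (u := u) (b := (2 * ‖u‖) ^ σ) (fun j hj ↦ ?_)
        (by positivity)
      · simpa using this
      · calc ‖u‖ ^ j ≤ (2 * ‖u‖) ^ j := by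
              gcongr; linarith
          _ = (2 * ‖u‖) ^ (j : ℝ) := (Real.rpow_natCast _ _).symm
          _ ≤ (2 * ‖u‖) ^ σ := by
              refine Real.rpow_le_rpow_of_exponent_le (by linarith) ?_
              exact (Nat.cast_le.2 (Nat.lt_succ_iff.1 hj)).trans (Nat.floor_le hσ.le)
    rw [elementaryFactor, norm_mul, Complex.norm_exp]
    calc ‖1 + u‖ * Real.exp (-Complex.logTaylor (⌊σ⌋₊ + 1) u).re
        ≤ Real.exp (3 ^ σ / σ * ‖u‖ ^ σ) * Real.exp ((⌊σ⌋₊ + 1) * (2 * ‖u‖) ^ σ) := by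
          gcongr
          refine (Complex.re_le_norm _).trans ?_
          rwa [norm_neg]
      _ = Real.exp ((3 ^ σ / σ + (⌊σ⌋₊ + 1) * 2 ^ σ) * ‖u‖ ^ σ) := by
          rw [← Real.exp_add, Real.mul_rpow (by norm_num) (norm_nonneg _)]
          ring_nf
      _ ≤ _ := by
          gcongr
          linarith

/-- The factor at `a` of the canonical product with zeros of multiplicity `m a` at `a ≠ 0`. -/
def canonicalFactor (p : ℕ) (m : ℂ → ℕ) (a z : ℂ) : ℂ := elementaryFactor p (-(z / a)) ^ m a

/-- The canonical product of genus `p` with zeros of multiplicity `m a` at each `a ≠ 0`. -/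
def canonicalProduct (p : ℕ) (m : ℂ → ℕ) (z : ℂ) : ℂ := ∏' a, canonicalFactor p m a z

lemma differentiable_canonicalFactor (p : ℕ) (m : ℂ → ℕ) (a : ℂ) :
    Differentiable ℂ (canonicalFactor p m a) := by
  have := differentiable_elementaryFactor p
  unfold canonicalFactor
  fun_prop

lemma eventually_norm_canonicalFactor_sub_one_le {σ : ℝ} (hσ : 0 < σ) {m : ℂ → ℕ}
    (hm : Summable fun a ↦ m a * ‖a‖ ^ (-σ)) (R : ℝ) :
    ∀ᶠ a in cofinite, ∀ z ∈ ball (0 : ℂ) R,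
      ‖canonicalFactor ⌊σ⌋₊ m a z - 1‖ ≤ 4 * R ^ σ * (m a * ‖a‖ ^ (-σ)) := by
  have hlim : Tendsto (fun a ↦ R ^ σ * (m a * ‖a‖ ^ (-σ))) cofinite (nhds 0) := by
    simpa using hm.tendsto_cofinite_zero.const_mul (R ^ σ)
  have hδ : 0 < min ((1 / 2 : ℝ) ^ σ) (1 / 2) := by positivity
  filter_upwards [hlim.eventually_le_const hδ] with a ha z hz
  have hz : ‖z‖ < R := by simpa using hz
  have hR : 0 < R := (norm_nonneg z).trans_lt hz
  rcases Nat.eq_zero_or_pos (m a) with h0 | h0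
  · simp [canonicalFactor, h0]
  have hm1 : (1 : ℝ) ≤ m a := by exact_mod_cast h0
  have hza : ‖-(z / a)‖ ^ σ ≤ R ^ σ * ‖a‖ ^ (-σ) := by
    rw [norm_neg, norm_div, Real.div_rpow (norm_nonneg _) (norm_nonneg _), div_eq_mul_inv,
      Real.rpow_neg (norm_nonneg _)]
    gcongr
  have hza' : m a * ‖-(z / a)‖ ^ σ ≤ R ^ σ * (m a * ‖a‖ ^ (-σ)) := by
    calc m a * ‖-(z / a)‖ ^ σ ≤ m a * (R ^ σ * ‖a‖ ^ (-σ)) := by gcongr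
      _ = _ := by ring
  have hle : ‖-(z / a)‖ ≤ 1 / 2 := by
    refine (Real.rpow_le_rpow_iff (norm_nonneg _) (by norm_num) hσ).1 ?_
    refine (le_mul_of_one_le_left (by positivity) hm1).trans
      ((hza'.trans ha).trans (min_le_left _ _))
  obtain ⟨l, hl, hl'⟩ := exists_elementaryFactor_eq_exp (σ := σ) hle
  have hml : ‖m a * l‖ ≤ 2 * (m a * ‖-(z / a)‖ ^ σ) := by
    rw [norm_mul, Complex.norm_natCast]
    calc m a * ‖l‖ ≤ m a * (2 * ‖-(z / a)‖ ^ σ) := by gcongr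
      _ = _ := by ring
  have hsmall : ‖m a * l‖ ≤ 1 := by
    linarith [ha.trans (min_le_right _ _)]
  rw [canonicalFactor, hl, ← Complex.exp_nat_mul]
  refine (Complex.norm_exp_sub_one_le hsmall).trans ?_
  linarith

lemma summable_norm_canonicalFactor_sub_one {σ : ℝ} (hσ : 0 < σ) {m : ℂ → ℕ}
    (hm : Summable fun a ↦ m a * ‖a‖ ^ (-σ)) (z : ℂ) :
    Summable fun a ↦ ‖canonicalFactor ⌊σ⌋₊ m a z - 1‖ := by
  refine Summable.of_norm_bounded_eventually (hm.mul_left (4 * (‖z‖ + 1) ^ σ)) ?_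
  filter_upwards [eventually_norm_canonicalFactor_sub_one_le hσ hm (‖z‖ + 1)] with a ha
  simpa using ha z (by simp)

lemma multipliable_canonicalFactor {σ : ℝ} (hσ : 0 < σ) {m : ℂ → ℕ}
    (hm : Summable fun a ↦ m a * ‖a‖ ^ (-σ)) (z : ℂ) :
    Multipliable fun a ↦ canonicalFactor ⌊σ⌋₊ m a z := by
  have := multipliable_one_add_of_summable (summable_norm_canonicalFactor_sub_one hσ hm z)
  simpa using this

lemma differentiable_canonicalProduct {σ : ℝ} (hσ : 0 < σ) {m : ℂ → ℕ}
    (hm : Summable fun a ↦ m a * ‖a‖ ^ (-σ)) :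
    Differentiable ℂ (canonicalProduct ⌊σ⌋₊ m) := by
  intro z
  have hprod := Summable.hasProdLocallyUniformlyOn_one_add (K := ball (0 : ℂ) (‖z‖ + 1))
    (f := fun a z ↦ canonicalFactor ⌊σ⌋₊ m a z - 1) isOpen_ball
    (hm.mul_left (4 * (‖z‖ + 1) ^ σ))
    (eventually_norm_canonicalFactor_sub_one_le hσ hm (‖z‖ + 1))
    (fun a ↦ ((differentiable_canonicalFactor ⌊σ⌋₊ m a).continuous.sub
      continuous_const).continuousOn)
  simp only [add_sub_cancel] at hprod
  rw [hasProdLocallyUniformlyOn_iff_tendstoLocallyUniformlyOn] at hprod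
  have := hprod.differentiableOn (Eventually.of_forall fun s ↦ ?_) isOpen_ball
  · exact this.differentiableAt (isOpen_ball.mem_nhds (by simp))
  · exact (Differentiable.fun_finsetProd
      fun a _ ↦ differentiable_canonicalFactor ⌊σ⌋₊ m a).differentiableOn

lemma hasExpGrowth_canonicalProduct {σ : ℝ} (hσ : 0 < σ) {m : ℂ → ℕ}
    (hm : Summable fun a ↦ m a * ‖a‖ ^ (-σ)) :
    HasExpGrowth σ (canonicalProduct ⌊σ⌋₊ m) := by
  refine ⟨differentiable_canonicalProduct hσ hm, ?_⟩
  obtain ⟨C, hC, h⟩ := exists_norm_elementaryFactor_le hσ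
  have hpos : ∀ a, 0 ≤ m a * ‖a‖ ^ (-σ) := fun a ↦ by positivity
  refine ⟨C * ∑' a, m a * ‖a‖ ^ (-σ), mul_nonneg hC (tsum_nonneg hpos), fun z ↦ ?_⟩
  refine le_of_tendsto (multipliable_canonicalFactor hσ hm z).hasProd.norm
    (Eventually.of_forall fun s ↦ ?_)
  beta_reduce
  calc ∏ a ∈ s, ‖canonicalFactor ⌊σ⌋₊ m a z‖
      ≤ ∏ a ∈ s, Real.exp (C * ‖z‖ ^ σ * (m a * ‖a‖ ^ (-σ))) := by
        refine Finset.prod_le_prod (fun _ _ ↦ norm_nonneg _) fun a _ ↦ ?_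
        rw [canonicalFactor, norm_pow]
        refine (pow_le_pow_left₀ (norm_nonneg _) (h _) _).trans (le_of_eq ?_)
        rw [← Real.exp_nat_mul, norm_neg, norm_div,
          Real.div_rpow (norm_nonneg _) (norm_nonneg _), Real.rpow_neg (norm_nonneg _)]
        ring_nf
    _ = Real.exp (C * ‖z‖ ^ σ * ∑ a ∈ s, m a * ‖a‖ ^ (-σ)) := by
        rw [← Real.exp_sum, Finset.mul_sum]
    _ ≤ _ := by
        refine Real.exp_le_exp.2 ?_
        rw [mul_right_comm]
        have h1 := hm.sum_le_tsum s fun a _ ↦ hpos a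
        have h2 : 0 ≤ ∑' a, m a * ‖a‖ ^ (-σ) := tsum_nonneg hpos
        gcongr
        linarith

lemma canonicalProduct_ne_zero {σ : ℝ} (hσ : 0 < σ) {m : ℂ → ℕ}
    (hm : Summable fun a ↦ m a * ‖a‖ ^ (-σ)) {z : ℂ} (hz : z = 0 ∨ m z = 0) :
    canonicalProduct ⌊σ⌋₊ m z ≠ 0 := by
  have := tprod_one_add_ne_zero_of_summable (f := fun a ↦ canonicalFactor ⌊σ⌋₊ m a z - 1)
    (fun a ↦ ?_) (summable_norm_canonicalFactor_sub_one hσ hm z)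
  · simpa [canonicalProduct] using this
  · rw [add_sub_cancel, canonicalFactor]
    rcases hz with rfl | hz
    · simp [elementaryFactor_zero]
    rcases eq_or_ne a 0 with rfl | ha
    · simp [elementaryFactor_zero]
    rcases eq_or_ne a z with rfl | haz
    · simp [hz]
    refine pow_ne_zero _ (elementaryFactor_ne_zero _ fun h ↦ haz ?_)
    field_simp at h
    linear_combination h

lemma canonicalProduct_eq_mul_update {σ : ℝ} (hσ : 0 < σ) {m : ℂ → ℕ} (a z : ℂ)
    (hm' : Summable fun b ↦ (Function.update m a 0 b : ℝ) * ‖b‖ ^ (-σ)) :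
    canonicalProduct ⌊σ⌋₊ m z
      = canonicalFactor ⌊σ⌋₊ m a z * canonicalProduct ⌊σ⌋₊ (Function.update m a 0) z := by
  have h := (multipliable_canonicalFactor hσ hm' z).hasProd.mul
    (hasProd_ite_eq a (canonicalFactor ⌊σ⌋₊ m a z))
  rw [mul_comm]
  refine HasProd.tprod_eq ?_
  convert h using 1
  · ext b
    rcases eq_or_ne b a with rfl | hb
    · simp [canonicalFactor]
    · simp [canonicalFactor, hb]
  · rfl

lemma analyticOrderAt_canonicalProduct {σ : ℝ} (hσ : 0 < σ) {m : ℂ → ℕ}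
    (hm : Summable fun a ↦ m a * ‖a‖ ^ (-σ)) {a : ℂ} (ha : a ≠ 0) :
    analyticOrderAt (canonicalProduct ⌊σ⌋₊ m) a = m a := by
  have hm' : Summable fun b ↦ (Function.update m a 0 b : ℝ) * ‖b‖ ^ (-σ) := by
    refine Summable.of_nonneg_of_le (fun b ↦ by positivity) (fun b ↦ ?_) hm
    rcases eq_or_ne b a with rfl | hb
    · simpa using by positivity
    · simp [hb]
  rw [((differentiable_canonicalProduct hσ hm).analyticAt a).analyticOrderAt_eq_natCast]
  have hd := differentiable_canonicalProduct hσ hm'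
  have hl := differentiable_logTaylor (⌊σ⌋₊ + 1)
  refine ⟨fun z ↦ (-a⁻¹ * Complex.exp (-Complex.logTaylor (⌊σ⌋₊ + 1) (-(z / a)))) ^ m a
    * canonicalProduct ⌊σ⌋₊ (Function.update m a 0) z, ?_, ?_, Eventually.of_forall fun z ↦ ?_⟩
  · refine Differentiable.analyticAt ?_ a
    fun_prop
  · refine mul_ne_zero (pow_ne_zero _ (mul_ne_zero (by simpa using ha) (Complex.exp_ne_zero _)))
      (canonicalProduct_ne_zero hσ hm' (by simp))
  · rw [canonicalProduct_eq_mul_update hσ a z hm', canonicalFactor, elementaryFactor,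
      smul_eq_mul, ← mul_assoc, ← mul_pow]
    congr 2
    field_simp
    ring

/-- A summable family of multiplicities is the zero set of an entire function of controlled
growth. -/
lemma exists_hasExpGrowth_analyticOrderAt {σ : ℝ} (hσ : 0 < σ) {m : ℂ → ℕ}
    (hm : Summable fun a ↦ m a * ‖a‖ ^ (-σ)) :
    ∃ H : ℂ → ℂ, HasExpGrowth σ H ∧ ∀ a, analyticOrderAt H a = m a := by
  have hP := hasExpGrowth_canonicalProduct hσ hm
  refine ⟨fun z ↦ z ^ m 0 * canonicalProduct ⌊σ⌋₊ m z,
    ((HasExpGrowth.id hσ).pow hσ.le _).mul hP, fun a ↦ ?_⟩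
  have hmul := analyticOrderAt_mul (f := fun z : ℂ ↦ z ^ m 0) (z₀ := a) (by fun_prop)
    (hP.1.analyticAt a)
  rw [show (fun z ↦ z ^ m 0 * canonicalProduct ⌊σ⌋₊ m z)
    = (fun z : ℂ ↦ z ^ m 0) * canonicalProduct ⌊σ⌋₊ m from rfl, hmul]
  rcases eq_or_ne a 0 with rfl | ha
  · rw [(hP.1.analyticAt 0).analyticOrderAt_eq_zero.2
      (canonicalProduct_ne_zero hσ hm (Or.inl rfl)), add_zero,
      AnalyticAt.analyticOrderAt_eq_natCast (by fun_prop)]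
    exact ⟨fun _ ↦ 1, by fun_prop, one_ne_zero, by simp⟩
  · rw [analyticOrderAt_canonicalProduct hσ hm ha,
      (AnalyticAt.analyticOrderAt_eq_zero (f := fun z : ℂ ↦ z ^ m 0) (by fun_prop)).2
        (pow_ne_zero _ ha), zero_add]

lemma Differentiable.exists_exp_eq {G : ℂ → ℂ} (hG : Differentiable ℂ G) (h0 : ∀ z, G z ≠ 0) :
    ∃ g : ℂ → ℂ, Differentiable ℂ g ∧ ∀ z, G z = Complex.exp (g z) := by
  obtain ⟨g, hg⟩ := Differentiable.isExactOn_univ (f := fun z ↦ _root_.deriv G z / G z)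
    (hG.deriv.div hG h0)
  have hg' : ∀ z, HasDerivAt g (_root_.deriv G z / G z) z := fun z ↦ hg z (Set.mem_univ z)
  have hgd : Differentiable ℂ g := fun z ↦ (hg' z).differentiableAt
  have hconst : ∀ z, G z * Complex.exp (-g z) = G 0 * Complex.exp (-g 0) := by
    intro z
    refine is_const_of_deriv_eq_zero (f := fun z ↦ G z * Complex.exp (-g z)) (by fun_prop)
      (fun z ↦ ?_) z 0
    have := (hG z).hasDerivAt.mul (hg' z).neg.cexp
    refine (HasDerivAt.deriv this).trans ?_
    have := h0 z
    simp only [Pi.neg_apply]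
    field_simp
    ring
  refine ⟨fun z ↦ g z + Complex.log (G 0 * Complex.exp (-g 0)), by fun_prop, fun z ↦ ?_⟩
  rw [Complex.exp_add, Complex.exp_log (mul_ne_zero (h0 0) (Complex.exp_ne_zero _)), ← hconst z,
    Complex.exp_neg]
  field_simp

lemma exists_eq_mul_exp_of_analyticOrderAt_eq {f H : ℂ → ℂ} (hf : Differentiable ℂ f)
    (hH : Differentiable ℂ H) (h0 : ∃ z, f z ≠ 0)
    (h : ∀ z, analyticOrderAt H z = analyticOrderAt f z) :
    ∃ g : ℂ → ℂ, Differentiable ℂ g ∧ ∀ z, f z = H z * Complex.exp (g z) := by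
  have hmf := hf.meromorphicOn Set.univ
  have hmH := hH.meromorphicOn Set.univ
  have hm : MeromorphicOn (f * H⁻¹) Set.univ := hmf.mul hmH.inv
  set G := toMeromorphicNFOn (f * H⁻¹) Set.univ with hG
  have hNF : MeromorphicNFOn G Set.univ := meromorphicNFOn_toMeromorphicNFOn _ _
  have hord : ∀ z, meromorphicOrderAt G z = 0 := by
    intro z
    rw [hG, meromorphicOrderAt_toMeromorphicNFOn hm (Set.mem_univ z),
      meromorphicOrderAt_mul (hmf z (Set.mem_univ z)) (hmH z (Set.mem_univ z)).inv,
      meromorphicOrderAt_inv, (hf.analyticAt z).meromorphicOrderAt_eq,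
      (hH.analyticAt z).meromorphicOrderAt_eq, h z]
    obtain ⟨n, hn⟩ := ENat.ne_top_iff_exists.1 (hf.analyticOrderAt_ne_top h0 z)
    rw [← hn]
    simp only [ENat.map_natCast]
    norm_cast
    simp
  have hGd : Differentiable ℂ G := fun z ↦
    ((hNF (Set.mem_univ z)).meromorphicOrderAt_nonneg_iff_analyticAt.1
      (hord z).ge).differentiableAt
  have hG0 : ∀ z, G z ≠ 0 := fun z ↦
    (hNF (Set.mem_univ z)).meromorphicOrderAt_eq_zero_iff.1 (hord z)
  have hfH : ∀ z, f z = H z * G z := by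
    intro z
    have hev := hm.toMeromorphicNFOn_eq_self_on_nhdsNE (Set.mem_univ z)
    have hHne : ∀ᶠ w in nhdsWithin z {z}ᶜ, H w ≠ 0 := by
      refine ((hH.analyticAt z).eventually_eq_zero_or_eventually_ne_zero).resolve_left ?_
      rw [← analyticOrderAt_eq_top, h z]
      exact hf.analyticOrderAt_ne_top h0 z
    have : ∀ᶠ w in nhdsWithin z {z}ᶜ, f w = H w * G w := by
      filter_upwards [hev, hHne] with w hw hw'
      rw [hG, hw]
      simp only [Pi.mul_apply, Pi.inv_apply]
      field_simp
    have h1 : Tendsto f (nhdsWithin z {z}ᶜ) (nhds (f z)) :=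
      hf.continuous.continuousAt.continuousWithinAt
    have h2 : Tendsto (fun w ↦ H w * G w) (nhdsWithin z {z}ᶜ) (nhds (H z * G z)) :=
      (hH.continuous.mul hGd.continuous).continuousAt.continuousWithinAt
    exact tendsto_nhds_unique (h1.congr' this) h2
  obtain ⟨g, hg, hg'⟩ := hGd.exists_exp_eq hG0
  exact ⟨g, hg, fun z ↦ by rw [hfH z, hg' z]⟩

lemma Differentiable.analyticOrderAt_eq_zeroMult {f : ℂ → ℂ} (hf : Differentiable ℂ f)
    (h0 : ∃ z, f z ≠ 0) (z : ℂ) : analyticOrderAt f z = zeroMult f z := by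
  obtain ⟨n, hn⟩ := ENat.ne_top_iff_exists.1 (hf.analyticOrderAt_ne_top h0 z)
  have h1 := (analyticOrderAt_eq_nat_iff_iteratedDeriv_eq_zero (hf.analyticAt z)).1 hn.symm
  rw [← hn]
  congr 1
  refine le_antisymm ?_ (Nat.sInf_le h1.2)
  refine le_csInf ⟨n, h1.2⟩ fun k hk ↦ ?_
  by_contra! hlt
  exact hk (h1.1 k hlt)

lemma zeroMult_eq_zero {f : ℂ → ℂ} {z : ℂ} (hz : f z ≠ 0) : zeroMult f z = 0 :=
  Nat.sInf_eq_zero.2 (Or.inl (by simpa using hz))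

lemma Differentiable.finite_zeroMult_ne_zero {f : ℂ → ℂ} (hf : Differentiable ℂ f)
    (h0 : ∃ z, f z ≠ 0) (r : ℝ) : {z ∈ closedBall (0 : ℂ) r | zeroMult f z ≠ 0}.Finite := by
  have := hf.eventually_codiscrete_ne_zero h0
  refine ((isCompact_closedBall (0 : ℂ) r).finite_sdiff_of_mem_codiscreteWithin
    (codiscreteWithin_mono (Set.subset_univ _) this)).subset fun z hz ↦ ⟨hz.1, fun h ↦ ?_⟩
  exact hz.2 (zeroMult_eq_zero h)

lemma summable_mul_rpow_of_finsum_le {m : ℂ → ℕ}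
    (hfin : ∀ r, {z ∈ closedBall (0 : ℂ) r | m z ≠ 0}.Finite) {σ τ : ℝ} (hτ : 0 < τ) (h : τ < σ)
    (hle : ∀ᶠ r : ℝ in atTop, ((∑ᶠ z ∈ closedBall (0 : ℂ) r, m z : ℕ) : ℝ) ≤ r ^ τ) :
    Summable fun a ↦ m a * ‖a‖ ^ (-σ) := by
  have hσ : 0 < σ := hτ.trans h
  have hcount : ∀ (s : Finset ℂ) (r : ℝ), (∀ a ∈ s, ‖a‖ ≤ r) →
      ∑ a ∈ s, m a ≤ ∑ᶠ z ∈ closedBall (0 : ℂ) r, m z := by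
    intro s r hs
    rw [finsum_mem_eq_sum_of_inter_support_eq (t := (hfin r).toFinset) m (by ext; simp)]
    refine Finset.sum_le_sum_of_ne_zero fun a ha hma ↦ ?_
    simpa [hma] using hs a ha
  obtain ⟨K, hK⟩ : ∃ K : ℝ, ∀ j : ℕ,
      ((∑ᶠ z ∈ closedBall (0 : ℂ) (2 ^ j), m z : ℕ) : ℝ) ≤ K * (2 ^ j : ℝ) ^ τ := by
    have hev : ∀ᶠ j : ℕ in atTop,
        ((∑ᶠ z ∈ closedBall (0 : ℂ) (2 ^ j), m z : ℕ) : ℝ) / (2 ^ j : ℝ) ^ τ ≤ 1 := by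
      have := (tendsto_pow_atTop_atTop_of_one_lt (one_lt_two (α := ℝ))).eventually hle
      filter_upwards [this] with j hj
      rw [div_le_one (by positivity)]
      exact hj
    obtain ⟨K, hK⟩ := IsBoundedUnder.bddAbove_range ⟨1, eventually_map.2 hev⟩
    exact ⟨K, fun j ↦ (div_le_iff₀ (by positivity)).1 (hK ⟨j, rfl⟩)⟩
  have hK0 : 0 ≤ K := by
    have := hK 0
    simp only [pow_zero, Real.one_rpow, mul_one] at this
    exact (Nat.cast_nonneg _).trans this
  have hb : Summable fun j : ℕ ↦ K * 2 ^ τ * ((2 : ℝ) ^ (τ - σ)) ^ j :=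
    (summable_geometric_of_lt_one (by positivity)
      (Real.rpow_lt_one_of_one_lt_of_neg one_lt_two (by linarith))).mul_left _
  have hnear : ∀ a : ℂ, 1 ≤ ‖a‖ → ∃ n : ℕ, (2 : ℝ) ^ n ≤ ‖a‖ ∧ ‖a‖ < 2 ^ (n + 1) :=
    fun a ha ↦ exists_nat_pow_near ha one_lt_two
  choose! j hj1 hj2 using hnear
  have hcongr : (fun a : ℂ ↦ (m a * ‖a‖ ^ (-σ) : ℝ)) =ᶠ[cofinite]
      fun a ↦ if 1 ≤ ‖a‖ then m a * ‖a‖ ^ (-σ) else 0 := by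
    refine (hfin 1).subset fun a ha ↦ ?_
    by_contra hcon
    refine ha ?_
    simp only [Set.mem_ofPred_eq, mem_closedBall, dist_zero_right, not_and, not_not] at hcon ⊢
    by_cases h1 : 1 ≤ ‖a‖
    · simp [h1]
    · simp [h1, hcon (le_of_not_ge h1)]
  rw [summable_congr_cofinite hcongr]
  refine summable_of_sum_le (c := ∑' j : ℕ, K * 2 ^ τ * ((2 : ℝ) ^ (τ - σ)) ^ j)
    (fun a ↦ ?_) fun s ↦ ?_
  · dsimp only
    split_ifs
    · positivity
    · exact le_rfl
  rw [← Finset.sum_filter]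
  set t := s.filter fun a ↦ 1 ≤ ‖a‖ with ht
  have ht1 : ∀ a ∈ t, 1 ≤ ‖a‖ := fun a ha ↦ (Finset.mem_filter.1 ha).2
  rw [← Finset.sum_fiberwise_of_maps_to (t := t.image j) (g := j)
    fun a ha ↦ Finset.mem_image_of_mem j ha]
  refine le_trans (Finset.sum_le_sum fun i _ ↦ ?_)
    (hb.sum_le_tsum (t.image j) fun i _ ↦ by positivity)
  calc ∑ a ∈ t with j a = i, (m a * ‖a‖ ^ (-σ) : ℝ)
      ≤ ∑ a ∈ t with j a = i, (m a * (2 ^ i : ℝ) ^ (-σ)) := by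
        refine Finset.sum_le_sum fun a ha ↦ ?_
        rw [Finset.mem_filter] at ha
        gcongr ?_ * ?_
        refine Real.rpow_le_rpow_of_nonpos (by positivity) ?_ (by linarith)
        rw [← ha.2]
        exact hj1 a (ht1 a ha.1)
    _ = ((∑ a ∈ t with j a = i, m a : ℕ) : ℝ) * (2 ^ i : ℝ) ^ (-σ) := by
        rw [← Finset.sum_mul]
        push_cast
        rfl
    _ ≤ (K * (2 ^ (i + 1) : ℝ) ^ τ) * (2 ^ i : ℝ) ^ (-σ) := by
        gcongr
        refine le_trans (Nat.cast_le.2 (hcount _ (2 ^ (i + 1)) fun a ha ↦ ?_)) (hK (i + 1))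
        rw [Finset.mem_filter] at ha
        rw [← ha.2]
        exact (hj2 a (ht1 a ha.1)).le
    _ = K * 2 ^ τ * ((2 : ℝ) ^ (τ - σ)) ^ i := by
        rw [pow_succ, Real.mul_rpow (by positivity) (by positivity), sub_eq_add_neg,
          Real.rpow_add two_pos, mul_pow, ← Real.rpow_natCast, ← Real.rpow_mul two_pos.le,
          ← Real.rpow_mul two_pos.le, ← Real.rpow_natCast, ← Real.rpow_natCast,
          ← Real.rpow_mul two_pos.le, ← Real.rpow_mul two_pos.le, mul_comm τ, mul_comm (-σ)]
        ring

lemma eventually_le_rpow_of_limsup_lt {u : ℝ → ℝ} {K : ℝ}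
    (h : limsup (fun r ↦ ((logPlus (u r) / Real.log r : ℝ) : EReal)) atTop < K) :
    ∀ᶠ r : ℝ in atTop, u r ≤ r ^ K := by
  filter_upwards [eventually_lt_of_limsup_lt h, eventually_gt_atTop 1] with r hr hr1
  rw [EReal.coe_lt_coe_iff, div_lt_iff₀ (Real.log_pos hr1)] at hr
  rcases le_or_gt (u r) 0 with hu | hu
  · exact hu.trans (by positivity)
  · rw [← Real.log_le_log_iff hu (by positivity), Real.log_rpow (by positivity)]
    exact (le_max_left _ _).trans hr.le

lemma limsup_le_of_eventually_le_rpow {u : ℝ → ℝ} (hu : ∀ r, 0 ≤ u r) {K C : ℝ} (hK : 0 ≤ K)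
    (h : ∀ᶠ r : ℝ in atTop, u r ≤ C * r ^ K) :
    limsup (fun r ↦ ((logPlus (u r) / Real.log r : ℝ) : EReal)) atTop ≤ K := by
  refine EReal.le_of_forall_lt_iff_le.1 fun L hL ↦ ?_
  rw [EReal.coe_lt_coe_iff] at hL
  refine limsup_le_of_le (h := ?_)
  have hbig := (tendsto_rpow_atTop (sub_pos.2 hL)).eventually_ge_atTop C
  filter_upwards [h, hbig, eventually_gt_atTop 1] with r hr hrC hr1
  have hr0 : 0 < r := by linarith
  rw [EReal.coe_le_coe_iff, div_le_iff₀ (Real.log_pos hr1)]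
  refine max_le ?_ (mul_nonneg (hK.trans hL.le) (Real.log_pos hr1).le)
  rcases (hu r).eq_or_lt with hu | hu
  · rw [← hu, Real.log_zero]
    exact mul_nonneg (hK.trans hL.le) (Real.log_pos hr1).le
  · rw [← Real.log_rpow hr0]
    refine Real.log_le_log hu (hr.trans ?_)
    calc C * r ^ K ≤ r ^ (L - K) * r ^ K := by gcongr
      _ = r ^ L := by rw [← Real.rpow_add hr0]; ring_nf

lemma nevCharEntire_nonneg (f : ℂ → ℂ) (r : ℝ) : 0 ≤ nevCharEntire f r := by
  refine mul_nonneg (by positivity) (intervalIntegral.integral_nonneg (by positivity) ?_)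
  exact fun _ _ ↦ le_max_right _ _

lemma limsup_logPlus_div_log_nonneg (u : ℝ → ℝ) :
    0 ≤ limsup (fun r ↦ ((logPlus (u r) / Real.log r : ℝ) : EReal)) atTop := by
  refine le_limsup_of_frequently_le (Eventually.frequently ?_)
  filter_upwards [eventually_ge_atTop 1] with r hr
  exact EReal.coe_nonneg.2 (div_nonneg (le_max_right _ _) (Real.log_nonneg hr))

/-- An entire function of finite order whose zeros have smaller exponent of convergence is of the
form `H e ^ P`, where `P` is a polynomial whose degree is the order of `f`. -/
lemma exists_eq_mul_exp_polynomial {f : ℂ → ℂ} (hf : Differentiable ℂ f) (h0 : ∃ z, f z ≠ 0)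
    (hord : growthOrderEntire f < ⊤) (hlr : zeroExponent f < growthOrderEntire f) :
    ∃ (σ : ℝ) (H : ℂ → ℂ) (P : Polynomial ℂ), 0 < σ ∧ HasExpGrowth σ H ∧
      (∀ z, f z = H z * Complex.exp (P.eval z)) ∧ σ < P.natDegree ∧
      growthOrderEntire f = (P.natDegree : ℝ) := by
  obtain ⟨σ, hσ1, hσ2⟩ := EReal.lt_iff_exists_real_btwn.1 hlr
  obtain ⟨τ, hτ1, hτ2⟩ := EReal.lt_iff_exists_real_btwn.1 hσ1
  have hτ : 0 < τ := EReal.coe_pos.1 ((limsup_logPlus_div_log_nonneg _).trans_lt hτ1)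
  have hτσ : τ < σ := EReal.coe_lt_coe_iff.1 hτ2
  have hσ : 0 < σ := hτ.trans hτσ
  obtain ⟨H, hH, hHord⟩ := exists_hasExpGrowth_analyticOrderAt hσ
    (summable_mul_rpow_of_finsum_le (hf.finite_zeroMult_ne_zero h0) hτ hτσ
      (eventually_le_rpow_of_limsup_lt hτ1))
  obtain ⟨g, hg, hfg⟩ := exists_eq_mul_exp_of_analyticOrderAt_eq hf hH.1 h0
    fun z ↦ by rw [hHord, hf.analyticOrderAt_eq_zeroMult h0]
  have hH0 : ∃ z, H z ≠ 0 := by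
    obtain ⟨z, hz⟩ := h0
    exact ⟨z, left_ne_zero_of_mul (hfg z ▸ hz)⟩
  obtain ⟨C, hC, hTH⟩ := hH.eventually_nevCharEntire_le hσ.le
  have hpoly : ∀ K : ℝ, growthOrderEntire f < K →
      ∃ P : Polynomial ℂ, (P.natDegree : ℝ) ≤ max σ K ∧ ∀ z, g z = P.eval z := by
    intro K hK
    refine exists_polynomial_of_mul_exp_eq (C := C + 1) hH.1 hf hg hH0 (fun z ↦ (hfg z).symm)
      (le_max_of_le_left hσ.le) ?_ ?_
    · filter_upwards [hTH, eventually_ge_atTop 1] with r hr hr1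
      refine hr.trans ?_
      gcongr
      · linarith
      · exact le_max_left _ _
    · filter_upwards [eventually_le_rpow_of_limsup_lt hK, eventually_ge_atTop 1] with r hr hr1
      refine hr.trans ?_
      have : r ^ K ≤ r ^ max σ K :=
        Real.rpow_le_rpow_of_exponent_le hr1 (le_max_right _ _)
      nlinarith [Real.rpow_nonneg (zero_le_one.trans hr1) (max σ K)]
  obtain ⟨K, hK, -⟩ := EReal.lt_iff_exists_real_btwn.1 hord
  obtain ⟨P, -, hP⟩ := hpoly K hK
  have hle : growthOrderEntire f ≤ (max σ P.natDegree : ℝ) := by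
    have hgr : HasExpGrowth (max σ P.natDegree) f := by
      rw [show f = fun z ↦ H z * Complex.exp (P.eval z) from funext fun z ↦ by rw [hfg, hP]]
      exact (hH.mono (le_max_left _ _)).mul (HasExpGrowth.exp_polynomial P (le_max_right _ _))
    obtain ⟨D, -, hD⟩ := hgr.eventually_nevCharEntire_le (le_max_of_le_left hσ.le)
    exact limsup_le_of_eventually_le_rpow (nevCharEntire_nonneg f) (le_max_of_le_left hσ.le) hD
  have hσd : σ < P.natDegree := by
    by_contra! hcon
    rw [max_eq_left hcon] at hle
    exact absurd hσ2 hle.not_gt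
  refine ⟨σ, H, P, hσ, hH, fun z ↦ by rw [hfg, hP], hσd, ?_⟩
  rw [max_eq_right hσd.le] at hle
  refine hle.antisymm (le_of_not_gt fun hlt ↦ ?_)
  obtain ⟨L, hL1, hL2⟩ := EReal.lt_iff_exists_real_btwn.1 hlt
  obtain ⟨P', hP', hPP'⟩ := hpoly L hL1
  have : P = P' := Polynomial.funext fun z ↦ by rw [← hP, hPP']
  subst this
  exact absurd hP' (max_lt hσd (EReal.coe_lt_coe_iff.1 hL2)).not_ge

lemma exists_mul_ne_zero {U V : ℂ → ℂ} (hU : Differentiable ℂ U) (hV : Differentiable ℂ V)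
    (hU0 : ∃ z, U z ≠ 0) (hV0 : ∃ z, V z ≠ 0) : ∃ z, U z * V z ≠ 0 := by
  by_contra! h
  rcases AnalyticOnNhd.eq_zero_or_eq_zero_of_mul_eq_zero (U := Set.univ)
    (fun z _ ↦ hU.analyticAt z) (fun z _ ↦ hV.analyticAt z) (fun z _ ↦ h z)
    isPreconnected_univ with h | h
  · obtain ⟨z, hz⟩ := hU0
    exact hz (h z (Set.mem_univ z))
  · obtain ⟨z, hz⟩ := hV0
    exact hz (h z (Set.mem_univ z))

lemma exists_const_mul_of_deriv_mul_eq {E R : ℂ → ℂ} (hE : Differentiable ℂ E)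
    (hR : Differentiable ℂ R) (hR0 : ∃ z, R z ≠ 0)
    (h : ∀ z, deriv E z * R z = E z * deriv R z) : ∃ k : ℂ, ∀ z, E z = k * R z := by
  obtain ⟨a, ha⟩ := hR0
  obtain ⟨ε, hε, hball⟩ := Metric.eventually_nhds_iff_ball.1
    (hR.continuous.continuousAt.eventually_ne ha)
  refine ⟨E a / R a, fun z ↦ ?_⟩
  refine congr_fun (AnalyticOnNhd.eq_of_eventuallyEq (z₀ := a) (fun z _ ↦ hE.analyticAt z)
    (g := fun z ↦ E a / R a * R z) (fun z _ ↦ (hR.const_mul _).analyticAt z) ?_) z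
  filter_upwards [ball_mem_nhds a hε] with w hw
  have hq : E w / R w = E a / R a := by
    refine isOpen_ball.is_const_of_deriv_eq_zero (f := fun z ↦ E z / R z)
      (convex_ball a ε).isPreconnected
      (fun z hz ↦ ((hE z).div (hR z) (hball z hz)).differentiableWithinAt) (fun z hz ↦ ?_) hw
      (mem_ball_self hε)
    have hd : deriv (fun z ↦ E z / R z) z = _ :=
      ((hE z).hasDerivAt.div (hR z).hasDerivAt (hball z hz)).deriv
    rw [hd, h z]
    simp
  rw [← hq, div_mul_cancel₀ _ (hball w hw)]

lemma hasDerivAt_mul_exp_polynomial {A : ℂ → ℂ} (hA : Differentiable ℂ A) (T : Polynomial ℂ)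
    (z : ℂ) : HasDerivAt (fun z ↦ A z * Complex.exp (T.eval z))
      ((deriv A z + A z * T.derivative.eval z) * Complex.exp (T.eval z)) z := by
  refine ((hA z).hasDerivAt.mul (T.hasDerivAt z).cexp).congr_deriv ?_
  ring

/-- A Borel-type lemma for three terms: in `A e ^ T + B e ^ S = R ≢ 0` with `A ≢ 0` and with
coefficients of growth at most `σ`, the polynomial `T` has degree at most `σ`. -/
lemma natDegree_le_of_add_mul_exp_eq {σ : ℝ} (hσ : 0 < σ) {A B R : ℂ → ℂ}
    (hA : HasExpGrowth σ A) (hB : HasExpGrowth σ B) (hR : HasExpGrowth σ R)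
    (hA0 : ∃ z, A z ≠ 0) (hR0 : ∃ z, R z ≠ 0) {T S : Polynomial ℂ}
    (h : ∀ z, A z * Complex.exp (T.eval z) + B z * Complex.exp (S.eval z) = R z) :
    (T.natDegree : ℝ) ≤ σ := by
  rcases le_or_gt ((T - S).natDegree : ℝ) σ with hD | hD
  · have hU : HasExpGrowth σ fun z ↦ A z * Complex.exp ((T - S).eval z) + B z :=
      (hA.mul (HasExpGrowth.exp_polynomial _ hD)).add hσ.le hB
    have hUV : ∀ z, (A z * Complex.exp ((T - S).eval z) + B z) * Complex.exp (S.eval z)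
        = R z := by
      intro z
      rw [← h z, add_mul, mul_assoc, ← Complex.exp_add, Polynomial.eval_sub, sub_add_cancel]
    have hS := hU.natDegree_le hσ.le hR
      (by
        obtain ⟨z, hz⟩ := hR0
        exact ⟨z, left_ne_zero_of_mul (hUV z ▸ hz)⟩) hUV
    have : T.natDegree ≤ max (T - S).natDegree S.natDegree := by
      simpa using Polynomial.natDegree_add_le (T - S) S
    calc (T.natDegree : ℝ) ≤ (max (T - S).natDegree S.natDegree : ℕ) := by exact_mod_cast this
      _ ≤ σ := by
        rw [Nat.cast_max]
        exact max_le hD hS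
  · have hpoly := fun P : Polynomial ℂ ↦ HasExpGrowth.polynomial hσ P
    have hA1 := (hA.deriv hσ.le).add hσ.le (hA.mul (hpoly T.derivative))
    have hB1 := (hB.deriv hσ.le).add hσ.le (hB.mul (hpoly S.derivative))
    have hU := (hA1.mul hR).sub hσ.le (hA.mul (hR.deriv hσ.le))
    have hV := (hB.mul (hR.deriv hσ.le)).sub hσ.le (hB1.mul hR)
    have hRd : ∀ z, (deriv A z + A z * T.derivative.eval z) * Complex.exp (T.eval z)
        + (deriv B z + B z * S.derivative.eval z) * Complex.exp (S.eval z) = deriv R z := by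
      intro z
      rw [← show _ = R from funext h]
      exact ((hasDerivAt_mul_exp_polynomial hA.1 T z).add
        (hasDerivAt_mul_exp_polynomial hB.1 S z)).deriv.symm
    have hUV : ∀ z, ((deriv A z + A z * T.derivative.eval z) * R z - A z * deriv R z)
        * Complex.exp ((T - S).eval z)
        = B z * deriv R z - (deriv B z + B z * S.derivative.eval z) * R z := by
      intro z
      rw [Polynomial.eval_sub, Complex.exp_sub, ← hRd z, ← h z]
      field_simp
      ring
    have hU0 : ∀ z, (deriv A z + A z * T.derivative.eval z) * R z - A z * deriv R z = 0 := by
      by_contra! hcon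
      exact absurd (hU.natDegree_le hσ.le hV hcon hUV) hD.not_ge
    have hE : Differentiable ℂ fun z ↦ A z * Complex.exp (T.eval z) :=
      fun z ↦ (hasDerivAt_mul_exp_polynomial hA.1 T z).differentiableAt
    obtain ⟨k, hk⟩ := exists_const_mul_of_deriv_mul_eq hE hR.1 hR0 fun z ↦ by
      rw [(hasDerivAt_mul_exp_polynomial hA.1 T z).deriv]
      linear_combination Complex.exp (T.eval z) * hU0 z
    exact hA.natDegree_le hσ.le (hR.const_mul hσ.le k) hA0 hk

lemma hasExpGrowth_exp_const_mul {σ : ℝ} (hσ : 1 ≤ σ) (α : ℂ) :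
    HasExpGrowth σ fun z ↦ Complex.exp (α * z) := by
  have : ((Polynomial.C α * Polynomial.X).natDegree : ℝ) ≤ σ := by
    refine le_trans ?_ hσ
    exact_mod_cast (Polynomial.natDegree_C_mul_le α _).trans_eq Polynomial.natDegree_X
  simpa using HasExpGrowth.exp_polynomial _ this

lemma exists_const_mul_exp_add_ne_zero {p₁ p₂ α₁ α₂ : ℂ} (hp₁ : p₁ ≠ 0) (hα : α₁ ≠ α₂) :
    ∃ z, p₁ * Complex.exp (α₁ * z) + p₂ * Complex.exp (α₂ * z) ≠ 0 := by
  by_contra! h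
  have h0 := h 0
  have hd : HasDerivAt (fun z ↦ p₁ * Complex.exp (α₁ * z) + p₂ * Complex.exp (α₂ * z))
      (p₁ * (Complex.exp (α₁ * 0) * (α₁ * 1)) + p₂ * (Complex.exp (α₂ * 0) * (α₂ * 1))) 0 :=
    (((hasDerivAt_id 0).const_mul α₁).cexp.const_mul p₁).add
      (((hasDerivAt_id 0).const_mul α₂).cexp.const_mul p₂)
  rw [funext h] at hd
  have h1 := hd.unique (hasDerivAt_const 0 0)
  simp only [mul_zero, Complex.exp_zero, mul_one, one_mul] at h0 h1
  have : p₁ * (α₁ - α₂) = 0 := by linear_combination h1 - α₂ * h0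
  rcases mul_eq_zero.1 this with h | h
  · exact hp₁ h
  · exact hα (sub_eq_zero.1 h)

lemma exists_add_mul_deriv_ne_zero {σ : ℝ} (hσ : 1 ≤ σ) {H : ℂ → ℂ} (hH : HasExpGrowth σ H)
    (hH0 : ∃ z, H z ≠ 0) {P : Polynomial ℂ} (hP : σ < P.natDegree) {w : ℂ} (hw : w ≠ 0) :
    ∃ z, H z + w * (deriv H z + H z * P.derivative.eval z) ≠ 0 := by
  by_contra! h
  have hσ0 : 0 ≤ σ := zero_le_one.trans hσ
  set L : Polynomial ℂ := Polynomial.C w⁻¹ * Polynomial.X with hL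
  have hLd : L.natDegree ≤ 1 := (Polynomial.natDegree_C_mul_le _ _).trans_eq Polynomial.natDegree_X
  have hlt : L.natDegree < P.natDegree := by
    have : (1 : ℝ) < P.natDegree := hσ.trans_lt hP
    exact hLd.trans_lt (by exact_mod_cast this)
  have hder := hasDerivAt_mul_exp_polynomial hH.1 (P + L)
  have hconst : ∀ z, H z * Complex.exp ((P + L).eval z)
      = H 0 * Complex.exp ((P + L).eval 0) := by
    refine fun z ↦ is_const_of_deriv_eq_zero (fun z ↦ (hder z).differentiableAt) (fun z ↦ ?_) z 0
    rw [(hder z).deriv]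
    have hz := h z
    simp only [hL, Polynomial.derivative_add, Polynomial.eval_add, Polynomial.derivative_C_mul,
      Polynomial.derivative_X, mul_one, Polynomial.eval_C]
    have : deriv H z + H z * (P.derivative.eval z + w⁻¹) = 0 := by
      field_simp
      linear_combination hz
    rw [this, zero_mul]
  have := hH.natDegree_le hσ0 (HasExpGrowth.const hσ0 _) hH0 hconst
  rw [Polynomial.natDegree_add_eq_left_of_natDegree_lt hlt] at this
  exact absurd hP this.not_gt

theorem statement3 (n : ℕ) (hn : n = 3) (c w p₁ p₂ α₁ α₂ : ℂ)
    (hw : w ≠ 0) (hc : c ≠ 0) (hp₁ : p₁ ≠ 0) (hp₂ : p₂ ≠ 0) (hα₁ : α₁ ≠ 0) (hα₂ : α₂ ≠ 0)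
    (hα : α₁ ≠ α₂) (q Q : Polynomial ℂ) (hq : q ≠ 0) (hQ : 0 < Q.natDegree)
    (f : ℂ → ℂ) (hf : Differentiable ℂ f)
    (htrans : TranscendentalEntire f) (hord : growthOrderEntire f < ⊤)
    (hlr : zeroExponent f < growthOrderEntire f)
    (heq : ∀ z : ℂ, f z ^ n + w * f z ^ (n - 1) * deriv f z
        + q.eval z * Complex.exp (Q.eval z) * f (z + c)
      = p₁ * Complex.exp (α₁ * z) + p₂ * Complex.exp (α₂ * z)) :
    growthOrderEntire f = (1 : EReal) ∧ Q.natDegree = 1 := by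
  subst hn
  have h0 : ∃ z, f z ≠ 0 := by
    by_contra! h
    exact htrans ⟨0, by simpa using h⟩
  obtain ⟨σ₀, H, P, hσ₀, hH, hfP, hσd, hρ⟩ := exists_eq_mul_exp_polynomial hf h0 hord hlr
  have hH0 : ∃ z, H z ≠ 0 := by
    obtain ⟨z, hz⟩ := h0
    exact ⟨z, left_ne_zero_of_mul (hfP z ▸ hz)⟩
  set σ : ℝ := max σ₀ 1 with hσ_def
  have hσ1 : 1 ≤ σ := le_max_right _ _
  have hσ : 0 < σ := zero_lt_one.trans_le hσ1
  replace hH : HasExpGrowth σ H := hH.mono (le_max_left _ _)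
  have hd0 : 0 < P.natDegree := by exact_mod_cast hσ₀.trans hσd
  set Pc : Polynomial ℂ := P.comp (Polynomial.X + Polynomial.C c) with hPc
  have hPcd : Pc.natDegree = P.natDegree := by
    rw [hPc, Polynomial.natDegree_comp, Polynomial.natDegree_X_add_C, mul_one]
  set T : Polynomial ℂ := Polynomial.C 3 * P with hT
  have hTd : T.natDegree = P.natDegree := Polynomial.natDegree_C_mul three_ne_zero
  set X : ℂ → ℂ := fun z ↦ H z + w * (deriv H z + H z * P.derivative.eval z) with hX
  have hXg : HasExpGrowth σ X := hH.add hσ.le (((hH.deriv hσ.le).add hσ.le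
    (hH.mul (HasExpGrowth.polynomial hσ _))).const_mul hσ.le w)
  have hA : HasExpGrowth σ fun z ↦ H z ^ 2 * X z := (hH.pow hσ.le 2).mul hXg
  have hHc : HasExpGrowth σ fun z ↦ H (z + c) := hH.comp_add_const hσ.le c
  have hB : HasExpGrowth σ fun z ↦ q.eval z * H (z + c) :=
    (HasExpGrowth.polynomial hσ q).mul hHc
  have hR : HasExpGrowth σ fun z ↦ p₁ * Complex.exp (α₁ * z) + p₂ * Complex.exp (α₂ * z) :=
    ((hasExpGrowth_exp_const_mul hσ1 α₁).const_mul hσ.le p₁).add hσ.le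
      ((hasExpGrowth_exp_const_mul hσ1 α₂).const_mul hσ.le p₂)
  have hR0 := exists_const_mul_exp_add_ne_zero (p₂ := p₂) hp₁ hα
  have heq' : ∀ z, H z ^ 2 * X z * Complex.exp (T.eval z)
      + q.eval z * H (z + c) * Complex.exp ((Q + Pc).eval z)
      = p₁ * Complex.exp (α₁ * z) + p₂ * Complex.exp (α₂ * z) := by
    intro z
    have hder : deriv f z = (deriv H z + H z * P.derivative.eval z) * Complex.exp (P.eval z) := by
      rw [show f = fun z ↦ H z * Complex.exp (P.eval z) from funext hfP]
      exact (hasDerivAt_mul_exp_polynomial hH.1 P z).deriv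
    have hT3 : Complex.exp (T.eval z) = Complex.exp (P.eval z) ^ 3 := by
      rw [← Complex.exp_nat_mul]
      simp [hT]
    rw [← heq z, hder, hfP (z + c), hfP z, hT3, Polynomial.eval_add, Complex.exp_add, hX]
    simp only [hPc, Polynomial.eval_comp, Polynomial.eval_add, Polynomial.eval_X,
      Polynomial.eval_C]
    ring
  have hd1 : P.natDegree = 1 := by
    by_contra hne
    have hσP : σ < P.natDegree := max_lt hσd (by exact_mod_cast (by omega : 1 < P.natDegree))
    have hA0 : ∃ z, H z ^ 2 * X z ≠ 0 := by
      refine exists_mul_ne_zero (hH.pow hσ.le 2).1 hXg.1 ?_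
        (exists_add_mul_deriv_ne_zero hσ1 hH hH0 hσP hw)
      obtain ⟨z, hz⟩ := hH0
      exact ⟨z, pow_ne_zero 2 hz⟩
    have := natDegree_le_of_add_mul_exp_eq hσ hA hB hR hA0 hR0 heq'
    rw [hTd] at this
    exact absurd hσP this.not_gt
  refine ⟨by rw [hρ, hd1]; simp, ?_⟩
  by_contra hne
  have hQ2 : 1 < Q.natDegree := by omega
  have hB0 : ∃ z, q.eval z * H (z + c) ≠ 0 := by
    refine exists_mul_ne_zero q.differentiable hHc.1 ?_ ?_
    · by_contra! h
      exact hq (Polynomial.funext (by simpa using h))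
    · obtain ⟨z, hz⟩ := hH0
      exact ⟨z - c, by simpa using hz⟩
  have := natDegree_le_of_add_mul_exp_eq hσ hB hA hR hB0 hR0
    fun z ↦ (add_comm _ _).trans (heq' z)
  rw [Polynomial.natDegree_add_eq_left_of_natDegree_lt (by omega)] at this
  have hlt : σ < Q.natDegree := by
    have h1 : (1 : ℝ) < Q.natDegree := by exact_mod_cast hQ2
    rw [hd1] at hσd
    exact max_lt (hσd.trans (by simpa using h1)) h1
  exact absurd hlt this.not_gt
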